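/- Let P be an n×n real positive definite matrix with inverse Q = P⁻¹, let Ā be an n×n real matrix, let T be an m×m real positive definite matrix, let F be an m×n real matrix, let h : ℝⁿ → ℝⁿ be a function, and let α ∈ (0,1), φ > 0, κ > 0, b > 0 be reals satisfying α + (φ+1)·κ/φ ≤ 1 and (φ+1)·κ/((1−α)·φ) < b. Suppose: (i) α·P − (1+φ)·Āᵀ·P·Ā is positive definite; (ii) Q⁻¹ − Fᵀ·T⁻¹·F is positive definite; and (iii) h(e)ᵀ·P·h(e) ≤ κ for every e ∈ ℝⁿ with eᵀ·P·e ≤ 1. If the sequence e : ℕ → ℝⁿ satisfies e(t+1) = Ā·e(t) + h(e(t)) for all t and e(0)ᵀ·P·e(0) < 1, then: (a) e(t)ᵀ·P·e(t) < 1 for all t ∈ ℕ; (b) the actions a(t) = F·e(t) satisfy a(t)ᵀ·T⁻¹·a(t) < 1 for all t ∈ ℕ; and (c) there exists τ ∈ ℕ such that e(τ)ᵀ·P·e(τ) < b. -/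

import Mathlib

open Matrix

/-- Weighted Young inequality for the quadratic form of a positive semidefinite matrix. -/
lemma Matrix.PosSemidef.dotProduct_mulVec_add_le {ι : Type*} [Fintype ι] {P : Matrix ι ι ℝ}
    (hP : P.PosSemidef) {φ : ℝ} (hφ : 0 < φ) (x y : ι → ℝ) :
    (x + y) ⬝ᵥ (P *ᵥ (x + y)) ≤
      (1 + φ) * (x ⬝ᵥ (P *ᵥ x)) + (φ + 1) / φ * (y ⬝ᵥ (P *ᵥ y)) := by
  have hxy := hP.dotProduct_mulVec_nonneg (φ • x - y)
  simp only [star_trivial, mulVec_sub, mulVec_smul, sub_dotProduct, dotProduct_sub,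
    smul_dotProduct, dotProduct_smul, smul_eq_mul] at hxy
  simp only [mulVec_add, add_dotProduct, dotProduct_add]
  refine sub_nonneg.mp ((div_nonneg hxy hφ.le).trans_eq ?_)
  field_simp
  ring

/-- The quadratic form of `Bᵀ * M * B` is the quadratic form of `M` evaluated at `B *ᵥ x`. -/
lemma Matrix.dotProduct_transpose_mul_mul_mulVec {ι κ R : Type*} [Fintype ι] [Fintype κ]
    [CommSemiring R] (B : Matrix κ ι R) (M : Matrix κ κ R) (x : ι → R) :
    x ⬝ᵥ ((Bᵀ * M * B) *ᵥ x) = (B *ᵥ x) ⬝ᵥ (M *ᵥ (B *ᵥ x)) := by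
  rw [← mulVec_mulVec, ← mulVec_mulVec, dotProduct_mulVec, vecMul_transpose]

/-- A real sequence with `v (t + 1) ≤ α * v t + c` eventually drops below every level above the
fixed point `c / (1 - α)`. -/
lemma exists_lt_of_le_mul_add {v : ℕ → ℝ} {α c b : ℝ} (hα₀ : 0 ≤ α) (hα₁ : α < 1)
    (hv : ∀ t, v (t + 1) ≤ α * v t + c) (hb : c / (1 - α) < b) : ∃ t, v t < b := by
  set L := c / (1 - α) with hL
  have hfix : α * L + c = L := by
    have : 1 - α ≠ 0 := (sub_pos.mpr hα₁).ne'
    rw [hL]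
    field_simp
    ring
  have hgeom : ∀ t, v t ≤ α ^ t * (v 0 - L) + L := by
    intro t
    induction t with
    | zero => simp
    | succ t ih =>
      calc v (t + 1) ≤ α * v t + c := hv t
        _ ≤ α * (α ^ t * (v 0 - L) + L) + c := by gcongr
        _ = α ^ (t + 1) * (v 0 - L) + L := by linear_combination hfix
  have hlim : Filter.Tendsto (fun t => α ^ t * (v 0 - L) + L) Filter.atTop (nhds L) := by
    simpa using ((tendsto_pow_atTop_nhds_zero_of_lt_one hα₀ hα₁).mul_const (v 0 - L)).add_const L
  obtain ⟨t, ht⟩ := (hlim.eventually_lt_const hb).exists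
  exact ⟨t, (hgeom t).trans_lt ht⟩

/-- State-space core of the real-time patch theorem: forward invariance of the unit
ellipsoid of `P`, admissibility of the feedback actions `a(t) = F e(t)` within the unit
ellipsoid of `T⁻¹`, and eventual return to the sublevel set of level `b`. -/
theorem realtime_patch_core {n m : ℕ}
    (P : Matrix (Fin n) (Fin n) ℝ) (hP : P.PosDef)
    (Abar : Matrix (Fin n) (Fin n) ℝ)
    (T : Matrix (Fin m) (Fin m) ℝ) (hT : T.PosDef)
    (F : Matrix (Fin m) (Fin n) ℝ) (h : (Fin n → ℝ) → (Fin n → ℝ))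
    (α φ κ b : ℝ) (hα : α ∈ Set.Ioo (0 : ℝ) 1) (hφ : 0 < φ) (hκ : 0 < κ) (hb : 0 < b)
    (hsum : α + (φ + 1) * κ / φ ≤ 1)
    (hbb : (φ + 1) * κ / ((1 - α) * φ) < b)
    (hLMI : (α • P - (1 + φ) • (Abarᵀ * P * Abar)).PosDef)
    (hF : ((P⁻¹)⁻¹ - Fᵀ * T⁻¹ * F).PosDef)
    (hh : ∀ e : Fin n → ℝ, e ⬝ᵥ (P *ᵥ e) ≤ 1 → (h e) ⬝ᵥ (P *ᵥ (h e)) ≤ κ)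
    (e : ℕ → Fin n → ℝ) (hdyn : ∀ t, e (t + 1) = Abar *ᵥ e t + h (e t))
    (h0 : (e 0) ⬝ᵥ (P *ᵥ (e 0)) < 1) :
    (∀ t : ℕ, (e t) ⬝ᵥ (P *ᵥ (e t)) < 1) ∧
      (∀ t : ℕ, (F *ᵥ e t) ⬝ᵥ (T⁻¹ *ᵥ (F *ᵥ e t)) < 1) ∧
      (∃ τ : ℕ, (e τ) ⬝ᵥ (P *ᵥ (e τ)) < b) := by
  obtain ⟨hα₀, hα₁⟩ := hα
  have hstep : ∀ t, e t ⬝ᵥ (P *ᵥ e t) ≤ 1 →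
      e (t + 1) ⬝ᵥ (P *ᵥ e (t + 1)) ≤ α * (e t ⬝ᵥ (P *ᵥ e t)) + (φ + 1) * κ / φ := by
    intro t ht
    have hlmi := hLMI.posSemidef.dotProduct_mulVec_nonneg (e t)
    simp only [star_trivial, sub_mulVec, smul_mulVec, dotProduct_sub, dotProduct_smul,
      smul_eq_mul, dotProduct_transpose_mul_mul_mulVec] at hlmi
    calc e (t + 1) ⬝ᵥ (P *ᵥ e (t + 1))
        ≤ (1 + φ) * ((Abar *ᵥ e t) ⬝ᵥ (P *ᵥ (Abar *ᵥ e t))) +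
            (φ + 1) / φ * (h (e t) ⬝ᵥ (P *ᵥ h (e t))) := by
          rw [hdyn]
          exact hP.posSemidef.dotProduct_mulVec_add_le hφ _ _
      _ ≤ α * (e t ⬝ᵥ (P *ᵥ e t)) + (φ + 1) / φ * κ := by
          refine add_le_add (sub_nonneg.mp hlmi) ?_
          gcongr
          exact hh _ ht
      _ = α * (e t ⬝ᵥ (P *ᵥ e t)) + (φ + 1) * κ / φ := by ring
  have hsafe : ∀ t, e t ⬝ᵥ (P *ᵥ e t) < 1 := by
    intro t
    induction t with
    | zero => exact h0
    | succ t ih => nlinarith [hstep t ih.le]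
  refine ⟨hsafe, fun t => ?_, ?_⟩
  · have hact := hF.posSemidef.dotProduct_mulVec_nonneg (e t)
    rw [nonsing_inv_nonsing_inv P ((isUnit_iff_isUnit_det P).mp hP.isUnit)] at hact
    simp only [star_trivial, sub_mulVec, dotProduct_sub,
      dotProduct_transpose_mul_mul_mulVec] at hact
    exact (sub_nonneg.mp hact).trans_lt (hsafe t)
  · refine exists_lt_of_le_mul_add hα₀.le hα₁ (fun t => hstep t (hsafe t).le) ?_
    rwa [div_div, mul_comm φ]
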